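/- Let δ>0, M>0 with λ̃(M)>0, and let ξ1,ξ2∈Ω_{δ,M}. Define ξ̄1(t):=max{ξ1(t),ξ2(t)} and ξ̄2(t):=min{ξ1(t),ξ2(t)}. Then ξ̄1 and ξ̄2 are strictly increasing continuous functions, and for every t∈[0,δ] and every y∈[0,ξ̄2(t)], one has 0 ≤ ξ̄2^{-1}(y) − ξ̄1^{-1}(y) ≤ (1/λ̃(M))·‖ξ1−ξ2‖_{C⁰([0,δ])}, where ‖·‖_{C⁰([0,δ])} denotes the supremum norm on [0,δ]. -/

import Mathlib

open MeasureTheory Set intervalIntegral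

noncomputable section

/-- `λ̃(M) = inf_{0 ≤ W ≤ M} λ(W)`. -/
def lamInf (lam : ℝ → ℝ) (M : ℝ) : ℝ := sInf (lam '' Set.Icc 0 M)

/-- `λ̄(M) = sup_{0 ≤ W ≤ M} λ(W)`. -/
def lamSup (lam : ℝ → ℝ) (M : ℝ) : ℝ := sSup (lam '' Set.Icc 0 M)

/-- `d(M) = sup_{0 ≤ W ≤ M} |λ'(W)|`. -/
def lamD (lam : ℝ → ℝ) (M : ℝ) : ℝ := sSup ((fun w => |deriv lam w|) '' Set.Icc 0 M)

/-- The set `Ω_{δ,M}` of continuous `ξ` on `[0,δ]` with `ξ(0) = 0` and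
difference quotients between `λ̃(M)` and `λ̄(M)`. -/
def Omega (lam : ℝ → ℝ) (δ M : ℝ) : Set (ℝ → ℝ) :=
  {ξ | ContinuousOn ξ (Set.Icc 0 δ) ∧ ξ 0 = 0 ∧
    ∀ t ∈ Set.Icc (0:ℝ) δ, ∀ s ∈ Set.Icc (0:ℝ) δ, t < s →
      lamInf lam M ≤ (ξ s - ξ t) / (s - t) ∧ (ξ s - ξ t) / (s - t) ≤ lamSup lam M}

/-- The map `F(ξ)(t) = ∫₀ᵗ λ(∫₀ˢ u(σ)dσ + ∫₀^{1-ξ(s)} ρ₀(x)dx) ds`. -/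
def Fmap (lam ρ₀ u : ℝ → ℝ) (ξ : ℝ → ℝ) (t : ℝ) : ℝ :=
  ∫ s in (0:ℝ)..t, lam ((∫ σ in (0:ℝ)..s, u σ) + ∫ x in (0:ℝ)..(1 - ξ s), ρ₀ x)

/-- The sup norm `‖f‖_{C⁰([0,δ])}`. -/
def supNorm (δ : ℝ) (f : ℝ → ℝ) : ℝ := sSup ((fun t => |f t|) '' Set.Icc 0 δ)

/-- Elements of `Omega lam δ M` grow at least at rate `lamInf lam M`. -/
theorem Omega.lamInf_mul_sub_le {lam : ℝ → ℝ} {δ M : ℝ} {ξ : ℝ → ℝ} (hξ : ξ ∈ Omega lam δ M)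
    {t s : ℝ} (ht : t ∈ Set.Icc 0 δ) (hs : s ∈ Set.Icc 0 δ) (hts : t < s) :
    ξ t + lamInf lam M * (s - t) ≤ ξ s := by
  have h := (le_div_iff₀ (sub_pos.2 hts)).1 (hξ.2.2 t ht s hs hts).1
  linarith

theorem abs_le_supNorm {δ : ℝ} {f : ℝ → ℝ} (hf : ContinuousOn f (Set.Icc 0 δ))
    {t : ℝ} (ht : t ∈ Set.Icc 0 δ) : |f t| ≤ supNorm δ f :=
  le_csSup (isCompact_Icc.image_of_continuousOn hf.abs).bddAbove (Set.mem_image_of_mem _ ht)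

/-- For `ξ₁, ξ₂ ∈ Ω_{δ,M}`, the pointwise max `ξ̄₁` and min `ξ̄₂` are strictly
increasing continuous functions, and their inverse functions satisfy
`0 ≤ ξ̄₂⁻¹(y) − ξ̄₁⁻¹(y) ≤ (1/λ̃(M)) ‖ξ₁ − ξ₂‖_{C⁰([0,δ])}` for `y ∈ [0, ξ̄₂(t)]`. -/
theorem max_min_inverse_estimate
    (lam : ℝ → ℝ) (hlam : ContDiff ℝ 1 lam) (hlam_pos : ∀ w, 0 < lam w)
    (δ M : ℝ) (hδ : 0 < δ) (hM : 0 < M) (hinf : 0 < lamInf lam M)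
    (ξ₁ ξ₂ : ℝ → ℝ) (hξ₁ : ξ₁ ∈ Omega lam δ M) (hξ₂ : ξ₂ ∈ Omega lam δ M) :
    StrictMonoOn (fun t => max (ξ₁ t) (ξ₂ t)) (Set.Icc 0 δ) ∧
    StrictMonoOn (fun t => min (ξ₁ t) (ξ₂ t)) (Set.Icc 0 δ) ∧
    ContinuousOn (fun t => max (ξ₁ t) (ξ₂ t)) (Set.Icc 0 δ) ∧
    ContinuousOn (fun t => min (ξ₁ t) (ξ₂ t)) (Set.Icc 0 δ) ∧
    ∀ t ∈ Set.Icc (0:ℝ) δ, ∀ y ∈ Set.Icc (0:ℝ) (min (ξ₁ t) (ξ₂ t)),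
      ∀ s₁ ∈ Set.Icc (0:ℝ) δ, ∀ s₂ ∈ Set.Icc (0:ℝ) δ,
        max (ξ₁ s₁) (ξ₂ s₁) = y → min (ξ₁ s₂) (ξ₂ s₂) = y →
          0 ≤ s₂ - s₁ ∧
          s₂ - s₁ ≤ (1 / lamInf lam M) * supNorm δ (fun t => ξ₁ t - ξ₂ t) := by
  have growth_max : ∀ t ∈ Set.Icc 0 δ, ∀ s ∈ Set.Icc 0 δ, t < s →
      max (ξ₁ t) (ξ₂ t) + lamInf lam M * (s - t) ≤ max (ξ₁ s) (ξ₂ s) := by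
    intro t ht s hs hts
    rw [← max_add_add_right]
    exact max_le_max (Omega.lamInf_mul_sub_le hξ₁ ht hs hts)
      (Omega.lamInf_mul_sub_le hξ₂ ht hs hts)
  have growth_min : ∀ t ∈ Set.Icc 0 δ, ∀ s ∈ Set.Icc 0 δ, t < s →
      min (ξ₁ t) (ξ₂ t) + lamInf lam M * (s - t) ≤ min (ξ₁ s) (ξ₂ s) := by
    intro t ht s hs hts
    rw [← min_add_add_right]
    exact min_le_min (Omega.lamInf_mul_sub_le hξ₁ ht hs hts)
      (Omega.lamInf_mul_sub_le hξ₂ ht hs hts)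
  have mono_min : StrictMonoOn (fun t => min (ξ₁ t) (ξ₂ t)) (Set.Icc 0 δ) := by
    intro t ht s hs hts
    exact (lt_add_of_pos_right _ (mul_pos hinf (sub_pos.2 hts))).trans_le (growth_min t ht s hs hts)
  refine ⟨fun t ht s hs hts => (lt_add_of_pos_right _ (mul_pos hinf (sub_pos.2 hts))).trans_le
    (growth_max t ht s hs hts), mono_min, ContinuousOn.sup hξ₁.1 hξ₂.1, ContinuousOn.inf hξ₁.1 hξ₂.1, ?_⟩
  intro _ _ y _ s₁ hs₁ s₂ hs₂ h₁ h₂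
  have hle : s₁ ≤ s₂ := by
    refine (mono_min.le_iff_le hs₁ hs₂).1 ?_
    exact min_le_max.trans (h₁.trans h₂.symm).le
  refine ⟨sub_nonneg.2 hle, ?_⟩
  have hnorm : |ξ₁ s₁ - ξ₂ s₁| ≤ supNorm δ (fun t => ξ₁ t - ξ₂ t) :=
    abs_le_supNorm (hξ₁.1.sub hξ₂.1) hs₁
  rw [one_div, ← div_eq_inv_mul, le_div_iff₀ hinf, mul_comm]
  refine le_trans ?_ hnorm
  rcases hle.eq_or_lt with rfl | hlt
  · simp
  · rw [← max_sub_min_eq_abs']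
    linarith [growth_min s₁ hs₁ s₂ hs₂ hlt]
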